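/- (Pointwise variance-difference bound for dominated value functions; core step of the lemma bounding σ²_{P,i}(V*) − σ²_{P,i}(V^π).) Let p_1,…,p_n be pmfs on S_1,…,S_n, let H ≥ 0, and let V, W : S → ℝ satisfy 0 ≤ W(s) ≤ V(s) ≤ H for all s ∈ S. Then for every i ∈ {1,…,n}: σ²_i(p, V) − σ²_i(p, W) ≤ 2H Σ_{s∈S} (⊗p)(s) ( V(s) − W(s) ). -/

import Mathlib

open Finset

variable {n : ℕ}

/-- `p` is a probability mass function on a finite type. -/
def IsPmf {X : Type} [Fintype X] (p : X → ℝ) : Prop :=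
  (∀ x, 0 ≤ p x) ∧ ∑ x, p x = 1

/-- L1 distance between two real-valued functions on a finite type. -/
def l1dist {X : Type} [Fintype X] (p q : X → ℝ) : ℝ :=
  ∑ x, |p x - q x|

/-- Merge a choice of coordinates below `i`, the coordinate at `i`, and
coordinates above `i` into a full state. -/
def merge (S : Fin n → Type) (i : Fin n)
    (a : ∀ j : {j : Fin n // j < i}, S j.1) (b : S i)
    (c : ∀ j : {j : Fin n // i < j}, S j.1) : ∀ j, S j := fun j =>
  if h : j < i then a ⟨j, h⟩
  else if h' : i < j then c ⟨j, h'⟩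
  else cast (congrArg S (le_antisymm (not_lt.mp h') (not_lt.mp h))).symm b

/-- `G S p V i a b` : expectation of `V` over the coordinates above `i`
(drawn independently from `p j`), given values `a` below `i` and `b` at `i`. -/
def G (S : Fin n → Type) [∀ i, Fintype (S i)] (p : ∀ i, S i → ℝ)
    (V : (∀ i, S i) → ℝ) (i : Fin n)
    (a : ∀ j : {j : Fin n // j < i}, S j.1) (b : S i) : ℝ :=
  ∑ c : ∀ j : {j : Fin n // i < j}, S j.1,
    (∏ j, p j.1 (c j)) * V (merge S i a b c)

/-- The `i`-th factored conditional variance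
`σ²_i(p, V) = E_{s[1:i-1]}[ Var_{s[i]}( E_{s[i+1:n]}[V(s)] ) ]`. -/
def facVar (S : Fin n → Type) [∀ i, Fintype (S i)] (p : ∀ i, S i → ℝ)
    (V : (∀ i, S i) → ℝ) (i : Fin n) : ℝ :=
  ∑ a : ∀ j : {j : Fin n // j < i}, S j.1,
    (∏ j, p j.1 (a j)) *
      ((∑ b : S i, p i b * (G S p V i a b) ^ 2)
        - (∑ b : S i, p i b * G S p V i a b) ^ 2)

theorem Fin.prod_eq_prod_lt_mul_mul_prod_gt {M : Type*} [CommMonoid M] (i : Fin n)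
    (f : Fin n → M) :
    ∏ j, f j = (∏ j : {j : Fin n // j < i}, f j) * f i * ∏ j : {j : Fin n // i < j}, f j := by
  rw [← Finset.prod_subtype (Iio i) (fun _ => mem_Iio) f,
    ← Finset.prod_subtype (Ioi i) (fun _ => mem_Ioi) f,
    mul_comm (∏ j ∈ Iio i, f j), ← Finset.prod_insert (by simp),
    ← Finset.prod_union (by
      rw [Finset.disjoint_left]
      intro j hj
      simp only [mem_insert, mem_Iio, mem_Ioi] at hj ⊢
      omega)]
  congr 1
  ext j
  simp only [mem_univ, mem_union, mem_insert, mem_Iio, mem_Ioi, true_iff]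
  omega

section Merge

variable (S : Fin n → Type) (i : Fin n) (a : ∀ j : {j : Fin n // j < i}, S j.1) (b : S i)
  (c : ∀ j : {j : Fin n // i < j}, S j.1)

theorem merge_of_lt (j : {j : Fin n // j < i}) : merge S i a b c j = a j := by
  simp [merge, j.2]

theorem merge_self : merge S i a b c i = b := by
  simp [merge]

theorem merge_of_gt (j : {j : Fin n // i < j}) : merge S i a b c j = c j := by
  simp [merge, j.2, j.2.le]

theorem merge_restrict (s : ∀ j, S j) :
    merge S i (fun j => s j) (s i) (fun j => s j) = s := by
  funext j
  rcases lt_trichotomy j i with h | rfl | h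
  · exact merge_of_lt S i _ _ _ ⟨j, h⟩
  · exact merge_self S j _ _ _
  · exact merge_of_gt S i _ _ _ ⟨j, h⟩

/-- Splitting a full state into the coordinates below, at and above `i`; the inverse is `merge`. -/
def splitEquiv : ((∀ j : {j : Fin n // j < i}, S j.1) × S i × (∀ j : {j : Fin n // i < j}, S j.1))
    ≃ ∀ j, S j where
  toFun x := merge S i x.1 x.2.1 x.2.2
  invFun s := (fun j => s j, s i, fun j => s j)
  left_inv x := by
    simp only [merge_of_lt, merge_self, merge_of_gt]
  right_inv s := merge_restrict S i s

end Merge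

section Expectation

variable (S : Fin n → Type) [∀ i, Fintype (S i)] (p : ∀ i, S i → ℝ)

theorem sum_prod_mul_eq_sum_G (V : (∀ i, S i) → ℝ) (i : Fin n) :
    ∑ s : ∀ i, S i, (∏ j, p j (s j)) * V s
      = ∑ a : ∀ j : {j : Fin n // j < i}, S j.1,
          (∏ j, p j.1 (a j)) * ∑ b : S i, p i b * G S p V i a b := by
  rw [← (splitEquiv S i).sum_comp, Fintype.sum_prod_type]
  refine sum_congr rfl fun a _ => ?_
  rw [Fintype.sum_prod_type, mul_sum]
  refine sum_congr rfl fun b _ => ?_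
  rw [G, mul_sum, mul_sum]
  refine sum_congr rfl fun c _ => ?_
  rw [Fin.prod_eq_prod_lt_mul_mul_prod_gt i]
  simp only [splitEquiv, Equiv.coe_fn_mk, merge_of_lt, merge_self, merge_of_gt]
  ring

variable {S p}

theorem G_mono (hp : ∀ i, IsPmf (p i)) {V W : (∀ i, S i) → ℝ} (h : ∀ s, W s ≤ V s) (i : Fin n)
    (a : ∀ j : {j : Fin n // j < i}, S j.1) (b : S i) : G S p W i a b ≤ G S p V i a b :=
  sum_le_sum fun _ _ => mul_le_mul_of_nonneg_left (h _) (prod_nonneg fun j _ => (hp j.1).1 _)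

theorem G_const (hp : ∀ i, IsPmf (p i)) (H : ℝ) (i : Fin n)
    (a : ∀ j : {j : Fin n // j < i}, S j.1) (b : S i) : G S p (fun _ => H) i a b = H := by
  rw [G, ← sum_mul, ← Fintype.prod_sum (fun (j : {j : Fin n // i < j}) x => p j.1 x)]
  simp [fun j => (hp j).2]

end Expectation

theorem IsPmf.variance_sub_variance_le {X : Type} [Fintype X] {q : X → ℝ} (hq : IsPmf q) {H : ℝ}
    {f g : X → ℝ} (hg : ∀ x, 0 ≤ g x) (hgf : ∀ x, g x ≤ f x) (hf : ∀ x, f x ≤ H) :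
    ((∑ x, q x * f x ^ 2) - (∑ x, q x * f x) ^ 2) - ((∑ x, q x * g x ^ 2) - (∑ x, q x * g x) ^ 2)
      ≤ 2 * H * (∑ x, q x * f x - ∑ x, q x * g x) := by
  have hmean : (∑ x, q x * g x) ^ 2 ≤ (∑ x, q x * f x) ^ 2 :=
    pow_le_pow_left₀ (sum_nonneg fun x _ => mul_nonneg (hq.1 x) (hg x))
      (sum_le_sum fun x _ => mul_le_mul_of_nonneg_left (hgf x) (hq.1 x)) 2
  have hsq : (∑ x, q x * f x ^ 2) - ∑ x, q x * g x ^ 2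
      ≤ 2 * H * (∑ x, q x * f x - ∑ x, q x * g x) := by
    rw [← sum_sub_distrib, ← sum_sub_distrib, mul_sum]
    refine sum_le_sum fun x _ => ?_
    have hx : f x ^ 2 - g x ^ 2 ≤ 2 * H * (f x - g x) := by
      nlinarith [hf x, hgf x]
    calc q x * f x ^ 2 - q x * g x ^ 2 = q x * (f x ^ 2 - g x ^ 2) := by ring
      _ ≤ q x * (2 * H * (f x - g x)) := mul_le_mul_of_nonneg_left hx (hq.1 x)
      _ = 2 * H * (q x * f x - q x * g x) := by ring
  linarith

/-- **Pointwise variance-difference bound for dominated value functions**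
(core step of the lemma bounding `σ²_{P,i}(V*) − σ²_{P,i}(V^π)`). -/
theorem facVar_difference_bound
    (hn : 1 ≤ n)
    (S : Fin n → Type) [∀ i, Fintype (S i)] [∀ i, Nonempty (S i)]
    (p : ∀ i, S i → ℝ) (hp : ∀ i, IsPmf (p i))
    (H : ℝ) (hH : 0 ≤ H)
    (V W : (∀ i, S i) → ℝ)
    (hVW : ∀ s, 0 ≤ W s ∧ W s ≤ V s ∧ V s ≤ H)
    (i : Fin n) :
    facVar S p V i - facVar S p W i
      ≤ 2 * H * ∑ s : ∀ i, S i, (∏ j, p j (s j)) * (V s - W s) := by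
  have hzero : ∀ a b, 0 ≤ G S p W i a b := fun a b =>
    (G_const hp 0 i a b).symm.trans_le (G_mono hp (fun s => (hVW s).1) i a b)
  have hle : ∀ a b, G S p V i a b ≤ H := fun a b =>
    (G_mono hp (fun s => (hVW s).2.2) i a b).trans_eq (G_const hp H i a b)
  simp only [mul_sub, sum_sub_distrib]
  rw [← mul_sub, sum_prod_mul_eq_sum_G S p V i, sum_prod_mul_eq_sum_G S p W i, facVar, facVar,
    ← sum_sub_distrib, ← sum_sub_distrib, mul_sum]
  refine sum_le_sum fun a _ => ?_
  rw [← mul_sub, ← mul_sub, mul_left_comm]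
  exact mul_le_mul_of_nonneg_left
    ((hp i).variance_sub_variance_le (hzero a) (G_mono hp (fun s => (hVW s).2.1) i a) (hle a))
    (prod_nonneg fun j _ => (hp j.1).1 _)
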